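/- Let P(m,n) = a m² + b m n + c n² + d m + e n + f₀ be an integral bivariate quadratic polynomial whose discriminant Δ = b² − 4ac is either negative, or positive and not a perfect square. Let 1 ≤ p < ∞ and λ > 1 − 1/p. Then, with α = 2cd − be, there is a constant C (depending only on λ, p, Δ, α) such that for every nonnegative f : ℤ → [0,∞], ∑_{n∈ℤ} ( ∑_{m∈ℤ, m≠0} f(P(m,n)) / |m|^λ )^p ≤ C^p · ∑_{k∈ℤ} f(k)^p (all sums taken in the extended nonnegative reals). -/

import Mathlib

open scoped ENNReal

/-- A linear function is dominated by any growing exponential. -/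
lemma natCast_add_one_le_mul_two_rpow {ε : ℝ} (hε : 0 < ε) (v : ℕ) :
    (v + 1 : ℝ) ≤ (1 + 1 / (ε * Real.log 2)) * (2 : ℝ) ^ ((v : ℝ) * ε) := by
  have hL : 0 < ε * Real.log 2 := mul_pos hε (Real.log_pos one_lt_two)
  have h1 : (v : ℝ) * (ε * Real.log 2) + 1 ≤ (2 : ℝ) ^ ((v : ℝ) * ε) := by
    rw [Real.rpow_def_of_pos two_pos]
    convert Real.add_one_le_exp _ using 2
    ring
  calc (v + 1 : ℝ) ≤ (1 + 1 / (ε * Real.log 2)) * ((v : ℝ) * (ε * Real.log 2) + 1) := by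
        have : (1 + 1 / (ε * Real.log 2)) * ((v : ℝ) * (ε * Real.log 2) + 1)
            = v + 1 + (v * (ε * Real.log 2) + 1 / (ε * Real.log 2)) := by field_simp; ring
        rw [this]
        have : 0 ≤ v * (ε * Real.log 2) + 1 / (ε * Real.log 2) := by positivity
        linarith
    _ ≤ _ := by gcongr

/-- Binary logarithms are dominated by any positive power. -/
lemma exists_natLog_add_one_le_mul_rpow {ε : ℝ} (hε : 0 < ε) :
    ∃ C : ℝ, 1 ≤ C ∧ ∀ n : ℕ, n ≠ 0 → ((Nat.log 2 n : ℕ) + 1 : ℝ) ≤ C * (n : ℝ) ^ ε := by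
  have hL : 0 < ε * Real.log 2 := mul_pos hε (Real.log_pos one_lt_two)
  refine ⟨1 + 1 / (ε * Real.log 2), le_add_of_nonneg_right (by positivity), fun n hn => ?_⟩
  refine (natCast_add_one_le_mul_two_rpow hε _).trans ?_
  gcongr
  rw [Real.rpow_mul two_pos.le, Real.rpow_natCast]
  gcongr
  exact_mod_cast Nat.pow_log_le_self 2 hn

/-- The divisor bound. -/
lemma exists_card_divisors_le_mul_rpow {ε : ℝ} (hε : 0 < ε) :
    ∃ C : ℝ, 1 ≤ C ∧ ∀ n : ℕ, n ≠ 0 → (n.divisors.card : ℝ) ≤ C * (n : ℝ) ^ ε := by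
  have hL : 0 < ε * Real.log 2 := mul_pos hε (Real.log_pos one_lt_two)
  set B : ℝ := 1 + 1 / (ε * Real.log 2) with hB
  have hB1 : 1 ≤ B := le_add_of_nonneg_right (by positivity)
  set T : ℕ := ⌈(2 : ℝ) ^ (1 / ε)⌉₊ with hT
  refine ⟨B ^ T, one_le_pow₀ hB1, fun n hn => ?_⟩
  have hfac : (n : ℝ) ^ ε
      = ∏ p ∈ n.primeFactors, (p : ℝ) ^ ((n.factorization p : ℝ) * ε) := by
    conv_lhs => rw [← Nat.prod_factorization_pow_eq_self hn]
    rw [Finsupp.prod, Nat.support_factorization, Nat.cast_prod,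
      ← Real.finsetProd_rpow _ _ (fun _ _ => by positivity)]
    refine Finset.prod_congr rfl fun p _ => ?_
    rw [Real.rpow_mul (Nat.cast_nonneg p), Real.rpow_natCast, Nat.cast_pow]
  have hterm : ∀ p ∈ n.primeFactors, ((n.factorization p + 1 : ℕ) : ℝ)
      ≤ (if p < T then B else 1) * (p : ℝ) ^ ((n.factorization p : ℝ) * ε) := by
    intro p hp
    have hp2 : (2 : ℝ) ≤ p := by exact_mod_cast (Nat.prime_of_mem_primeFactors hp).two_le
    split_ifs with h
    · push_cast
      refine (natCast_add_one_le_mul_two_rpow hε _).trans ?_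
      gcongr
    · have h2 : (2 : ℝ) ^ (1 / ε) ≤ p :=
        (Nat.le_ceil _).trans (by exact_mod_cast not_lt.mp h)
      have h3 : (2 : ℝ) ≤ (p : ℝ) ^ ε := by
        have := Real.rpow_le_rpow (by positivity) h2 hε.le
        rwa [← Real.rpow_mul two_pos.le, one_div, inv_mul_cancel₀ hε.ne', Real.rpow_one] at this
      rw [one_mul, mul_comm, Real.rpow_mul (Nat.cast_nonneg p), Real.rpow_natCast]
      calc ((n.factorization p + 1 : ℕ) : ℝ) ≤ (2 : ℝ) ^ n.factorization p := by
            exact_mod_cast Nat.lt_two_pow_self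
        _ ≤ _ := by gcongr
  rw [Nat.card_divisors hn, Nat.cast_prod, hfac]
  refine (Finset.prod_le_prod (fun _ _ => by positivity) hterm).trans ?_
  rw [Finset.prod_mul_distrib]
  gcongr
  rw [Finset.prod_ite, Finset.prod_const, Finset.prod_const_one, mul_one]
  refine pow_le_pow_right₀ hB1 ?_
  calc _ ≤ (Finset.range T).card := Finset.card_le_card fun p hp => by
        simpa using (Finset.mem_filter.mp hp).2
    _ = T := Finset.card_range T
/-- Representations of `N` by the form `x² - D y²` in the box `|x|, |y| ≤ X`. -/
noncomputable def normFormReps (D N : ℤ) (X : ℕ) : Finset (ℤ × ℤ) :=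
  (Finset.Icc (-X : ℤ) X ×ˢ Finset.Icc (-X : ℤ) X).filter fun z => z.1 ^ 2 - D * z.2 ^ 2 = N

lemma mem_normFormReps {D N : ℤ} {X : ℕ} {z : ℤ × ℤ} :
    z ∈ normFormReps D N X ↔ |z.1| ≤ X ∧ |z.2| ≤ X ∧ z.1 ^ 2 - D * z.2 ^ 2 = N := by
  simp [normFormReps, abs_le, and_assoc]

/-- Two representations in the same class differ by a unit of norm one. -/
lemma exists_unit_of_dvd {D N : ℤ} (hN : N ≠ 0) {z w : ℤ × ℤ}
    (hz : z.1 ^ 2 - D * z.2 ^ 2 = N) (hw : w.1 ^ 2 - D * w.2 ^ 2 = N)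
    (h1 : N ∣ z.1 * w.2 - w.1 * z.2) (h2 : N ∣ z.1 * w.1 - D * z.2 * w.2) :
    ∃ u v : ℤ, u ^ 2 - D * v ^ 2 = 1 ∧
      z.1 = u * w.1 - D * w.2 * v ∧ z.2 = u * w.2 - w.1 * v := by
  obtain ⟨v, hv⟩ := h1
  obtain ⟨u, hu⟩ := h2
  refine ⟨u, v, ?_, ?_, ?_⟩
  · apply mul_left_cancel₀ (pow_ne_zero 2 hN)
    have : (N * u) ^ 2 - D * (N * v) ^ 2 = N * N := by
      rw [← hu, ← hv]
      nth_rewrite 1 [← hz]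
      rw [← hw]
      ring
    linear_combination this
  · apply mul_left_cancel₀ hN
    linear_combination w.1 * hu - D * w.2 * hv - z.1 * hw
  · apply mul_left_cancel₀ hN
    linear_combination w.2 * hu - w.1 * hv - z.2 * hw

lemma card_class_le_of_neg {D N : ℤ} (hD : D < 0) (hN : N ≠ 0) {S : Finset (ℤ × ℤ)}
    (hS : ∀ z ∈ S, z.1 ^ 2 - D * z.2 ^ 2 = N)
    (hc : ∀ z ∈ S, ∀ w ∈ S,
      N ∣ z.1 * w.2 - w.1 * z.2 ∧ N ∣ z.1 * w.1 - D * z.2 * w.2) :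
    S.card ≤ 9 := by
  rcases S.eq_empty_or_nonempty with rfl | ⟨w, hw⟩
  · simp
  have hsub : S ⊆ (Finset.Icc (-1 : ℤ) 1 ×ˢ Finset.Icc (-1 : ℤ) 1).image
      fun q => (q.1 * w.1 - D * w.2 * q.2, q.1 * w.2 - w.1 * q.2) := by
    intro z hz
    obtain ⟨u, v, huv, hz1, hz2⟩ := exists_unit_of_dvd hN (hS z hz) (hS w hw)
      (hc z hz w hw).1 (hc z hz w hw).2
    refine Finset.mem_image.mpr ⟨(u, v), ?_, Prod.ext hz1.symm hz2.symm⟩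
    simp only [Finset.mem_product, Finset.mem_Icc]
    refine ⟨⟨?_, ?_⟩, ?_, ?_⟩ <;>
      nlinarith [sq_nonneg u, sq_nonneg v, mul_nonneg (neg_nonneg.mpr hD.le) (sq_nonneg v)]
  calc S.card ≤ _ := Finset.card_le_card hsub
    _ ≤ _ := Finset.card_image_le
    _ = 9 := by decide

lemma eq_of_log_eq {D N : ℤ} (hD : 0 < D) (hN : N ≠ 0) {z w : ℤ × ℤ}
    (hz : z.1 ^ 2 - D * z.2 ^ 2 = N) (hw : w.1 ^ 2 - D * w.2 ^ 2 = N)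
    (h1 : N ∣ z.1 * w.2 - w.1 * z.2) (h2 : N ∣ z.1 * w.1 - D * z.2 * w.2)
    (hsign : 0 < (z.1 + z.2 * √D) ↔ 0 < (w.1 + w.2 * √D))
    (hlog : Int.log 2 |z.1 + z.2 * √D| = Int.log 2 |w.1 + w.2 * √D|)
    (hz0 : z.1 + z.2 * √D ≠ 0) (hw0 : w.1 + w.2 * √D ≠ 0) : z = w := by
  obtain ⟨u, v, huv, hz1, hz2⟩ := exists_unit_of_dvd hN hz hw h1 h2
  have hDR : (1 : ℝ) ≤ D := by exact_mod_cast hD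
  have hs1 : 1 ≤ √(D : ℝ) := Real.one_le_sqrt.mpr hDR
  have hsq : √(D : ℝ) * √(D : ℝ) = D := Real.mul_self_sqrt (by linarith)
  set θz := z.1 + z.2 * √D with hθz
  set θw := w.1 + w.2 * √D with hθw
  set s : ℝ := u - v * √D with hs
  set t : ℝ := u + v * √D with ht
  have hrel : θz = s * θw := by
    rw [hθz, hθw, hs, hz1, hz2]
    push_cast
    linear_combination (-(w.2 : ℝ) * v) * (-hsq)
  have hst : s * t = 1 := by
    have : (u : ℝ) ^ 2 - D * v ^ 2 = 1 := by exact_mod_cast huv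
    rw [hs, ht]
    linear_combination this - (v : ℝ) ^ 2 * hsq
  have hspos : 0 < s := by
    rcases lt_or_gt_of_ne hw0 with h | h
    · have : ¬ 0 < θz := fun h' => absurd (hsign.mp h') h.not_gt
      have hz' : θz < 0 := lt_of_le_of_ne (not_lt.mp this) hz0
      rw [hrel] at hz'
      exact pos_of_mul_neg_left hz' h.le
    · have := hsign.mpr h
      rw [hrel] at this
      exact pos_of_mul_pos_left this h.le
  have habs : |θz| = s * |θw| := by rw [hrel, abs_mul, abs_of_pos hspos]
  have hzp := abs_pos.mpr hz0
  have hwp := abs_pos.mpr hw0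
  have a1 := Int.zpow_log_le_self (b := 2) one_lt_two hzp
  have a2 := Int.lt_zpow_succ_log_self (b := 2) one_lt_two |θz|
  have b1 := Int.zpow_log_le_self (b := 2) one_lt_two hwp
  have b2 := Int.lt_zpow_succ_log_self (b := 2) one_lt_two |θw|
  rw [hlog] at a1 a2
  rw [zpow_add₀ (by norm_num), zpow_one] at a2 b2
  set k := (((2 : ℕ) : ℝ)) ^ Int.log 2 |θw| with hk
  push_cast at a2 b2
  have hs2 : s < 2 := by
    by_contra! h
    nlinarith
  have hs3 : 1 < 2 * s := by
    by_contra! h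
    nlinarith
  have ht2 : t < 2 := by nlinarith
  have ht3 : 1 < 2 * t := by nlinarith
  have htpos : 0 < t := by linarith
  have hv : v = 0 := by
    have e : t - s = 2 * v * √D := by rw [hs, ht]; ring
    have hv1 : (v : ℝ) < 1 := by
      by_contra! h
      nlinarith
    have hv2 : (-1 : ℝ) < v := by
      by_contra! h
      nlinarith
    have hv1' : v < 1 := by exact_mod_cast hv1
    have hv2' : -1 < v := by exact_mod_cast hv2
    omega
  subst hv
  have hu : u = 1 := by
    have : (0 : ℝ) < u := by simpa [hs] using hspos
    have : 0 < u := by exact_mod_cast this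
    nlinarith
  subst hu
  exact Prod.ext (by simpa using hz1) (by simpa using hz2)

lemma card_class_le_of_pos {D N : ℤ} (hD : 0 < D) (hN : N ≠ 0) {X : ℕ}
    {S : Finset (ℤ × ℤ)} (hS : S ⊆ normFormReps D N X)
    (hc : ∀ z ∈ S, ∀ w ∈ S,
      N ∣ z.1 * w.2 - w.1 * z.2 ∧ N ∣ z.1 * w.1 - D * z.2 * w.2) :
    S.card ≤ 4 * (Nat.log 2 (X * (1 + D.natAbs)) + 1) := by
  have hDR : (1 : ℝ) ≤ D := by exact_mod_cast hD
  have hs1 : 1 ≤ √(D : ℝ) := Real.one_le_sqrt.mpr hDR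
  have hsq : √(D : ℝ) * √(D : ℝ) = D := Real.mul_self_sqrt (by linarith)
  have hsD : √(D : ℝ) ≤ D := by nlinarith
  set T : ℕ := X * (1 + D.natAbs) with hT
  have hTR : (T : ℝ) = X * (1 + D) := by
    rw [hT]; push_cast; rw [Nat.cast_natAbs, Int.cast_abs, abs_of_pos (by linarith)]
  set L := Nat.log 2 T with hL
  have hTL : (T : ℝ) < (2 : ℝ) ^ ((L : ℤ) + 1) := by
    have := Nat.lt_pow_succ_log_self one_lt_two T
    exact_mod_cast this
  have hbd : ∀ z ∈ S, |z.1 + z.2 * √D| ≤ T ∧ |z.1 - z.2 * √D| ≤ T := by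
    intro z hz
    obtain ⟨h1, h2, -⟩ := mem_normFormReps.mp (hS hz)
    have h1' : |(z.1 : ℝ)| ≤ X := by exact_mod_cast h1
    have h2' : |(z.2 : ℝ)| ≤ X := by exact_mod_cast h2
    have h3 : |(z.2 : ℝ) * √D| ≤ X * D := by
      rw [abs_mul, abs_of_pos (by linarith : 0 < √(D : ℝ))]; gcongr
    have e : (X : ℝ) * (1 + D) = X + X * D := by ring
    rw [hTR, e]
    exact ⟨(abs_add_le _ _).trans (by linarith), (abs_sub _ _).trans (by linarith)⟩
  have hprod : ∀ z ∈ S, (1 : ℝ) ≤ |z.1 + z.2 * √D| * |z.1 - z.2 * √D| := by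
    intro z hz
    obtain ⟨-, -, h⟩ := mem_normFormReps.mp (hS hz)
    have : (z.1 + z.2 * √D) * (z.1 - z.2 * √D) = (N : ℝ) := by
      rw [← h]; push_cast; linear_combination (-(z.2 : ℝ) ^ 2) * hsq
    rw [← abs_mul, this]
    exact_mod_cast Int.one_le_abs hN
  have hne : ∀ z ∈ S, z.1 + z.2 * √D ≠ 0 := by
    intro z hz h
    have := hprod z hz
    rw [h] at this
    norm_num at this
  have hmaps : ∀ z ∈ S, (decide (0 < z.1 + z.2 * √D), Int.log 2 |z.1 + z.2 * √D|) ∈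
      (Finset.univ : Finset Bool) ×ˢ Finset.Icc (-((L : ℤ) + 1)) L := by
    intro z hz
    obtain ⟨h1, h2⟩ := hbd z hz
    have hp := abs_pos.mpr (hne z hz)
    simp only [Finset.mem_product, Finset.mem_univ, true_and, Finset.mem_Icc]
    constructor
    · rw [← Int.zpow_le_iff_le_log one_lt_two hp, zpow_neg]
      refine inv_le_of_inv_le₀ hp ?_
      refine le_trans ?_ (le_of_lt hTL)
      rw [inv_le_iff_one_le_mul₀' hp]
      exact (hprod z hz).trans (by gcongr)
    · have := (Int.lt_zpow_iff_log_lt (b := 2) one_lt_two hp).mp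
        (h1.trans_lt (by exact_mod_cast hTL) : _ < (((2 : ℕ) : ℝ)) ^ ((L : ℤ) + 1))
      omega
  calc S.card ≤ _ := Finset.card_le_card_of_injOn _ hmaps (by
        intro z hz w hw h
        simp only [Prod.mk.injEq, decide_eq_decide] at h
        exact eq_of_log_eq hD hN (mem_normFormReps.mp (hS hz)).2.2
          (mem_normFormReps.mp (hS hw)).2.2 (hc z hz w hw).1 (hc z hz w hw).2 h.1 h.2
          (hne z hz) (hne w hw))
    _ = 4 * (L + 1) := by
        rw [Finset.card_product, Int.card_Icc, Finset.card_univ, Fintype.card_bool]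
        omega

lemma card_class_le {D N : ℤ} (hD : D ≠ 0) (hN : N ≠ 0) {X : ℕ}
    {S : Finset (ℤ × ℤ)} (hS : S ⊆ normFormReps D N X)
    (hc : ∀ z ∈ S, ∀ w ∈ S,
      N ∣ z.1 * w.2 - w.1 * z.2 ∧ N ∣ z.1 * w.1 - D * z.2 * w.2) :
    S.card ≤ 9 * (Nat.log 2 (X * (1 + D.natAbs)) + 1) := by
  rcases lt_or_gt_of_ne hD with h | h
  · refine (card_class_le_of_neg h hN (fun z hz => (mem_normFormReps.mp (hS hz)).2.2) hc).trans ?_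
    omega
  · exact (card_class_le_of_pos h hN hS hc).trans (by omega)

/-- Two square roots of `D` modulo `N` with the same gcd against a third one
agree up to a `4 * D`-torsion element. -/
lemma dvd_four_mul_sub_of_gcd_eq {D N r₀ r s : ℤ} (hN : N ≠ 0) (h₀ : N ∣ r₀ ^ 2 - D)
    (hr : N ∣ r ^ 2 - D) (hs : N ∣ s ^ 2 - D)
    (h : Int.gcd (r - r₀) N = Int.gcd (s - r₀) N) : N ∣ 4 * D * (r - s) := by
  set g : ℤ := ((Int.gcd (r - r₀) N : ℕ) : ℤ) with hg
  have hgN : g ∣ N := Int.gcd_dvd_right _ _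
  have hg0 : g ≠ 0 := fun h0 => hN (by rwa [h0, zero_dvd_iff] at hgN)
  obtain ⟨N', hN'⟩ := hgN
  have key : ∀ t : ℤ, g = Int.gcd (t - r₀) N → N ∣ t ^ 2 - D → g ∣ t - r₀ ∧ N' ∣ t + r₀ := by
    intro t hgt ht
    have hd : g ∣ t - r₀ := by rw [hgt]; exact Int.gcd_dvd_left _ _
    refine ⟨hd, ?_⟩
    obtain ⟨q, hq⟩ := hd
    have hcop : IsCoprime N' q := by
      have hb := Int.gcd_eq_gcd_ab (t - r₀) N
      rw [← hgt, hq, hN'] at hb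
      refine ⟨Int.gcdB (g * q) (g * N'), Int.gcdA (g * q) (g * N'), mul_left_cancel₀ hg0 ?_⟩
      linear_combination -hb
    have : N ∣ (t - r₀) * (t + r₀) := by
      rw [show (t - r₀) * (t + r₀) = t ^ 2 - D - (r₀ ^ 2 - D) by ring]
      exact dvd_sub ht h₀
    rw [hq, hN', mul_assoc] at this
    exact hcop.dvd_of_dvd_mul_left ((mul_dvd_mul_iff_left hg0).mp this)
  obtain ⟨hr1, hr2⟩ := key r hg hr
  obtain ⟨hs1, hs2⟩ := key s (by rw [hg, h]) hs
  have d1 : g ∣ r - s := by simpa using dvd_sub hr1 hs1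
  have d2 : N' ∣ r - s := by simpa using dvd_sub hr2 hs2
  set e : ℤ := ((Int.gcd g N' : ℕ) : ℤ) with he
  have e1 : e ∣ g := Int.gcd_dvd_left _ _
  have e2 : e ∣ N' := Int.gcd_dvd_right _ _
  have e3 : e ∣ 4 * D := by
    have a : e ∣ 2 * r₀ := by
      rw [show 2 * r₀ = r + r₀ - (r - r₀) by ring]
      exact dvd_sub (e2.trans hr2) (e1.trans hr1)
    have b : e ∣ r₀ ^ 2 - D := (e1.trans ⟨N', hN'⟩).trans h₀
    rw [show 4 * D = 2 * r₀ * (2 * r₀) - 4 * (r₀ ^ 2 - D) by ring]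
    exact dvd_sub (a.mul_right (2 * r₀)) (b.mul_left 4)
  have e4 : N ∣ e * (r - s) := by
    have hb : e = _ := Int.gcd_eq_gcd_ab g N'
    rw [hb, add_mul]
    refine dvd_add ?_ ?_
    · obtain ⟨k, hk⟩ := d2
      rw [hk, hN']
      exact ⟨Int.gcdA g N' * k, by ring⟩
    · obtain ⟨k, hk⟩ := d1
      rw [hk, hN']
      exact ⟨Int.gcdB g N' * k, by ring⟩
  exact e4.trans (mul_dvd_mul_right e3 _)

lemma exists_sqrt_mod_of_isCoprime {D N : ℤ} {z : ℤ × ℤ} (hz : z.1 ^ 2 - D * z.2 ^ 2 = N)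
    (hc : IsCoprime z.1 z.2) : ∃ r : ℤ, N ∣ r * z.2 - z.1 ∧ N ∣ r ^ 2 - D := by
  have h1 : IsCoprime N z.2 := by
    have : IsCoprime (z.1 ^ 2 + z.2 * (-D * z.2)) z.2 := hc.pow_left.add_mul_left_left _
    convert this using 1
    rw [← hz]; ring
  obtain ⟨a, b, hab⟩ := h1
  refine ⟨b * z.1, ⟨-a * z.1, by linear_combination z.1 * hab⟩, ?_⟩
  have h2 : IsCoprime N (z.2 ^ 2) := IsCoprime.pow_right ⟨a, b, hab⟩
  refine h2.dvd_of_dvd_mul_right ⟨b ^ 2 * z.2 ^ 2 + D * z.2 ^ 2 * (-2 * a + a ^ 2 * N), ?_⟩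
  have e : b * z.2 = 1 - a * N := by linear_combination hab
  linear_combination (b ^ 2 * z.2 ^ 2) * hz + (D * z.2 ^ 2 * (b * z.2 + 1 - a * N)) * e

lemma card_isCoprime_normFormReps_le {D N : ℤ} (hD : D ≠ 0) (hN : N ≠ 0) {X : ℕ}
    {S : Finset (ℤ × ℤ)} (hS : S ⊆ normFormReps D N X)
    (hc : ∀ z ∈ S, IsCoprime z.1 z.2) :
    S.card ≤ 9 * (Nat.log 2 (X * (1 + D.natAbs)) + 1) * (4 * D.natAbs) *
      N.natAbs.divisors.card := by
  rcases S.eq_empty_or_nonempty with rfl | ⟨z₀, hz₀⟩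
  · simp
  have hex : ∀ z ∈ S, ∃ r : ℤ, N ∣ r * z.2 - z.1 ∧ N ∣ r ^ 2 - D := fun z hz =>
    exists_sqrt_mod_of_isCoprime (mem_normFormReps.mp (hS hz)).2.2 (hc z hz)
  choose! r hr1 hr2 using hex
  refine Finset.card_le_mul_card_image_of_maps_to (f := fun z => Int.gcd (r z - r z₀) N)
    (fun z _ => Nat.mem_divisors.mpr ⟨Int.gcd_dvd_natAbs_right _ _, by simpa using hN⟩) _
    fun g _ => ?_
  rcases (S.filter fun z => Int.gcd (r z - r z₀) N = g).eq_empty_or_nonempty with h | ⟨z₁, hz₁⟩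
  · rw [h]; simp
  rw [Finset.mem_filter] at hz₁
  have h4D : 4 * D ≠ 0 := by simpa using hD
  have hcard : (Finset.Ico (0 : ℤ) |4 * D|).card = 4 * D.natAbs := by
    rw [Int.card_Ico, Int.abs_eq_natAbs]; omega
  rw [← hcard]
  refine Finset.card_le_mul_card_image_of_maps_to
    (f := fun z => (4 * D * (r z - r z₁) / N) % (4 * D))
    (fun z _ => Finset.mem_Ico.mpr ⟨Int.emod_nonneg _ h4D, Int.emod_lt_abs _ h4D⟩) _ fun q _ => ?_
  refine card_class_le hD hN
    ((Finset.filter_subset _ _).trans ((Finset.filter_subset _ _).trans hS)) fun z hz w hw => ?_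
  simp only [Finset.mem_filter] at hz hw
  obtain ⟨⟨hzS, hzg⟩, hzq⟩ := hz
  obtain ⟨⟨hwS, hwg⟩, hwq⟩ := hw
  have hrr : N ∣ r z - r w := by
    obtain ⟨k, hk⟩ := dvd_four_mul_sub_of_gcd_eq hN (hr2 z₀ hz₀) (hr2 z hzS) (hr2 z₁ hz₁.1)
      (hzg.trans hz₁.2.symm)
    obtain ⟨l, hl⟩ := dvd_four_mul_sub_of_gcd_eq hN (hr2 z₀ hz₀) (hr2 w hwS) (hr2 z₁ hz₁.1)
      (hwg.trans hz₁.2.symm)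
    rw [hk, Int.mul_ediv_cancel_left _ hN] at hzq
    rw [hl, Int.mul_ediv_cancel_left _ hN] at hwq
    obtain ⟨j, hj⟩ := Int.ModEq.dvd (show l % (4 * D) = k % (4 * D) from hwq.trans hzq.symm)
    refine ⟨j, mul_left_cancel₀ h4D ?_⟩
    linear_combination hk - hl + N * hj
  obtain ⟨a, ha⟩ := hr1 z hzS
  obtain ⟨b, hb⟩ := hr1 w hwS
  obtain ⟨c, hc'⟩ := hrr
  obtain ⟨k, hk⟩ := hr2 z hzS
  have ez : z.1 = r z * z.2 - N * a := by linear_combination -ha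
  have ew : w.1 = r z * w.2 - N * (c * w.2 + b) := by linear_combination -hb - w.2 * hc'
  constructor
  · refine ⟨-a * w.2 + (c * w.2 + b) * z.2, ?_⟩
    rw [ez, ew]; ring
  · refine ⟨k * z.2 * w.2 - r z * z.2 * (c * w.2 + b) - a * r z * w.2 + N * a * (c * w.2 + b), ?_⟩
    rw [ez, ew]
    linear_combination z.2 * w.2 * hk

lemma card_normFormReps_le {D N : ℤ} (hD : D ≠ 0) (hN : N ≠ 0) {X : ℕ} {B : ℕ}
    (hB : ∀ M : ℤ, M ≠ 0 → M.natAbs ≤ N.natAbs → M.natAbs.divisors.card ≤ B) :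
    (normFormReps D N X).card ≤
      9 * (Nat.log 2 (X * (1 + D.natAbs)) + 1) * (4 * D.natAbs) * B * B := by
  refine (Finset.card_le_mul_card_image_of_maps_to (f := fun z => Int.gcd z.1 z.2)
    (t := N.natAbs.divisors) ?_ _ fun g hg => ?_).trans
    (Nat.mul_le_mul_left _ (hB N hN le_rfl))
  · intro z hz
    obtain ⟨-, -, h⟩ := mem_normFormReps.mp hz
    refine Nat.mem_divisors.mpr ⟨Int.natCast_dvd.mp ?_, by simpa using hN⟩
    rw [← h]
    exact dvd_sub ((Int.gcd_dvd_left _ _).trans (dvd_pow_self _ two_ne_zero))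
      (((Int.gcd_dvd_right _ _).trans (dvd_pow_self _ two_ne_zero)).mul_left _)
  rcases ((normFormReps D N X).filter fun z => Int.gcd z.1 z.2 = g).eq_empty_or_nonempty
    with h | ⟨z₁, hz₁⟩
  · rw [h]; simp
  have hg0 : (g : ℤ) ≠ 0 := by
    have := Nat.pos_of_mem_divisors hg
    omega
  have hdiv : ∀ z ∈ (normFormReps D N X).filter fun z => Int.gcd z.1 z.2 = g,
      z.1 = g * (z.1 / g) ∧ z.2 = g * (z.2 / g) := by
    intro z hz
    obtain ⟨-, rfl⟩ := Finset.mem_filter.mp hz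
    exact ⟨(Int.mul_ediv_cancel' (Int.gcd_dvd_left _ _)).symm,
      (Int.mul_ediv_cancel' (Int.gcd_dvd_right _ _)).symm⟩
  obtain ⟨M, hM⟩ : ∃ M : ℤ, N = g ^ 2 * M := by
    obtain ⟨h1, h2⟩ := hdiv z₁ hz₁
    have h := (mem_normFormReps.mp (Finset.mem_filter.mp hz₁).1).2.2
    rw [h1, h2] at h
    exact ⟨(z₁.1 / g) ^ 2 - D * (z₁.2 / g) ^ 2, by rw [← h]; ring⟩
  have hM0 : M ≠ 0 := by rintro rfl; simp [hM] at hN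
  have hle : M.natAbs ≤ N.natAbs :=
    Nat.le_of_dvd (by omega) (Int.natAbs_dvd_natAbs.mpr ⟨(g : ℤ) ^ 2, by rw [hM]; ring⟩)
  rw [← Finset.card_image_of_injOn (f := fun z : ℤ × ℤ => (z.1 / (g : ℤ), z.2 / (g : ℤ)))]
  · refine (card_isCoprime_normFormReps_le (N := M) (X := X) hD hM0 ?_ ?_).trans
      (Nat.mul_le_mul_left _ (hB M hM0 hle))
    · intro q hq
      obtain ⟨z, hz, rfl⟩ := Finset.mem_image.mp hq
      obtain ⟨h1, h2⟩ := hdiv z hz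
      obtain ⟨b1, b2, h⟩ := mem_normFormReps.mp (Finset.mem_filter.mp hz).1
      have hg1 : (1 : ℤ) ≤ |(g : ℤ)| := Int.one_le_abs hg0
      refine mem_normFormReps.mpr ⟨?_, ?_, ?_⟩
      · rw [h1, abs_mul] at b1
        nlinarith [abs_nonneg (z.1 / (g : ℤ))]
      · rw [h2, abs_mul] at b2
        nlinarith [abs_nonneg (z.2 / (g : ℤ))]
      · apply mul_left_cancel₀ (pow_ne_zero 2 hg0)
        rw [← hM, ← h]
        nth_rewrite 3 [h1]
        nth_rewrite 3 [h2]
        ring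
    · intro q hq
      obtain ⟨z, hz, rfl⟩ := Finset.mem_image.mp hq
      have hgz := (Finset.mem_filter.mp hz).2
      have := Int.isCoprime_iff_gcd_eq_one.mpr
        (Int.gcd_div_gcd_div_gcd (i := z.1) (j := z.2) (by rw [hgz]; omega))
      rwa [hgz] at this
  · intro z hz w hw h
    obtain ⟨h1, h2⟩ := hdiv z hz
    obtain ⟨h3, h4⟩ := hdiv w hw
    simp only [Prod.mk.injEq] at h
    exact Prod.ext (by rw [h1, h3, h.1]) (by rw [h2, h4, h.2])

/-- The number of representations in a box is smaller than any power of its size. -/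
lemma exists_card_normFormReps_le_mul_rpow {D : ℤ} (hD : ¬ IsSquare D) {ε : ℝ} (hε : 0 < ε) :
    ∃ C : ℝ, 0 ≤ C ∧ ∀ (N : ℤ) (X : ℕ), X ≠ 0 →
      ((normFormReps D N X).card : ℝ) ≤ C * (X : ℝ) ^ ε := by
  have hD0 : D ≠ 0 := by rintro rfl; exact hD IsSquare.zero
  obtain ⟨C₁, hC₁, h₁⟩ := exists_natLog_add_one_le_mul_rpow (show 0 < ε / 3 by linarith)
  obtain ⟨C₂, hC₂, h₂⟩ := exists_card_divisors_le_mul_rpow (show 0 < ε / 6 by linarith)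
  set E : ℕ := 1 + D.natAbs with hE
  set A : ℝ := C₂ * (E : ℝ) ^ (ε / 6) with hA
  have hE1 : (1 : ℝ) ≤ E := by rw [hE]; push_cast; linarith [Nat.cast_nonneg (α := ℝ) D.natAbs]
  refine ⟨max 1 (9 * (C₁ * (E : ℝ) ^ (ε / 3)) * (4 * D.natAbs) * A * A), by positivity,
    fun N X hX => ?_⟩
  have hX1 : (1 : ℝ) ≤ X := by exact_mod_cast Nat.one_le_iff_ne_zero.mpr hX
  have hXε : 1 ≤ (X : ℝ) ^ ε := Real.one_le_rpow hX1 hε.le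
  rcases eq_or_ne N 0 with rfl | hN
  · have hsub : normFormReps D 0 X ⊆ {(0, 0)} := by
      intro z hz
      obtain ⟨-, -, h⟩ := mem_normFormReps.mp hz
      have hz2 : z.2 = 0 := by
        by_contra h2
        apply hD
        have hdvd : z.2 ∣ z.1 := (Int.pow_dvd_pow_iff two_ne_zero).mp ⟨D, by linear_combination h⟩
        obtain ⟨k, hk⟩ := hdvd
        refine ⟨k, mul_left_cancel₀ (pow_ne_zero 2 h2) ?_⟩
        rw [hk] at h
        linear_combination -h
      have hz1 : z.1 = 0 := by
        rw [hz2] at h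
        simpa using h
      simp [Prod.ext_iff, hz1, hz2]
    have hcard : ((normFormReps D 0 X).card : ℝ) ≤ 1 := by
      exact_mod_cast Finset.card_le_card hsub
    calc _ ≤ (1 : ℝ) * 1 := by linarith
      _ ≤ _ := by gcongr; exact le_max_left _ _
  rcases (normFormReps D N X).eq_empty_or_nonempty with h | ⟨z, hz⟩
  · rw [h]; simp; positivity
  have hNX : (N.natAbs : ℝ) ≤ E * (X : ℝ) ^ 2 := by
    obtain ⟨b1, b2, h⟩ := mem_normFormReps.mp hz
    have c1 : z.1 ^ 2 ≤ (X : ℤ) ^ 2 := sq_le_sq' (abs_le.mp b1).1 (abs_le.mp b1).2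
    have c2 : z.2 ^ 2 ≤ (X : ℤ) ^ 2 := sq_le_sq' (abs_le.mp b2).1 (abs_le.mp b2).2
    have : |N| ≤ (1 + |D|) * (X : ℤ) ^ 2 := by
      rw [← h]
      refine (abs_sub _ _).trans ?_
      rw [abs_mul, abs_of_nonneg (sq_nonneg z.1), abs_of_nonneg (sq_nonneg z.2)]
      nlinarith [abs_nonneg D]
    rw [Int.abs_eq_natAbs, Int.abs_eq_natAbs] at this
    exact_mod_cast this
  have hB : ∀ M : ℤ, M ≠ 0 → M.natAbs ≤ N.natAbs →
      M.natAbs.divisors.card ≤ ⌊A * (X : ℝ) ^ (ε / 3)⌋₊ := by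
    intro M hM hMN
    refine Nat.le_floor ((h₂ _ (by simpa using hM)).trans ?_)
    rw [hA, mul_assoc]
    gcongr
    calc (M.natAbs : ℝ) ^ (ε / 6) ≤ (E * (X : ℝ) ^ 2) ^ (ε / 6) := by
          gcongr
          exact le_trans (by exact_mod_cast hMN) hNX
      _ = _ := by
          rw [Real.mul_rpow (by positivity) (by positivity), ← Real.rpow_natCast,
            ← Real.rpow_mul (by positivity)]
          congr 2
          push_cast; ring
  have hmain := card_normFormReps_le hD0 hN (X := X) hB
  have hfl : (⌊A * (X : ℝ) ^ (ε / 3)⌋₊ : ℝ) ≤ A * (X : ℝ) ^ (ε / 3) :=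
    Nat.floor_le (by positivity)
  have hlog := h₁ (X * E) (by simp [hX, hE])
  rw [Nat.cast_mul, Real.mul_rpow (by positivity) (by positivity)] at hlog
  have hsplit : (X : ℝ) ^ ε = (X : ℝ) ^ (ε / 3) * (X : ℝ) ^ (ε / 3) * (X : ℝ) ^ (ε / 3) := by
    rw [← Real.rpow_add (by linarith), ← Real.rpow_add (by linarith)]
    congr 1; ring
  calc ((normFormReps D N X).card : ℝ)
      ≤ 9 * (Nat.log 2 (X * E) + 1) * (4 * D.natAbs) * ⌊A * (X : ℝ) ^ (ε / 3)⌋₊ *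
          ⌊A * (X : ℝ) ^ (ε / 3)⌋₊ := by exact_mod_cast hmain
    _ ≤ 9 * (C₁ * ((X : ℝ) ^ (ε / 3) * (E : ℝ) ^ (ε / 3))) * (4 * D.natAbs) *
          (A * (X : ℝ) ^ (ε / 3)) * (A * (X : ℝ) ^ (ε / 3)) := by gcongr
    _ = (9 * (C₁ * (E : ℝ) ^ (ε / 3)) * (4 * D.natAbs) * A * A) * (X : ℝ) ^ ε := by
        rw [hsplit]; ring
    _ ≤ _ := by gcongr; exact le_max_right _ _

lemma card_short_conic_le_four {D α K : ℤ} (hD : D ≠ 0) {B M : ℤ} (hB : B = |D| + 2 * |α|)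
    (hM : 1 ≤ M) (hK : (B + (2 * B + 1) ^ 2) * M ^ 4 < |K|) {S : Finset (ℤ × ℤ)}
    (hS : ∀ z ∈ S, |z.1| ≤ M ∧ z.2 ^ 2 = D * z.1 ^ 2 - 2 * α * z.1 + K) : S.card ≤ 4 := by
  rcases S.eq_empty_or_nonempty with rfl | ⟨w, hw⟩
  · simp
  have hB0 : 0 ≤ B := by rw [hB]; positivity
  have hM2 : M ≤ M ^ 2 := by nlinarith
  have hM4 : M ^ 2 ≤ M ^ 4 := by nlinarith [sq_nonneg M]
  have hbd : ∀ z ∈ S, |D * z.1 ^ 2 - 2 * α * z.1| ≤ B * M ^ 2 := by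
    intro z hz
    obtain ⟨h1, -⟩ := hS z hz
    have h2 : z.1 ^ 2 ≤ M ^ 2 := sq_le_sq' (abs_le.mp h1).1 (abs_le.mp h1).2
    calc |D * z.1 ^ 2 - 2 * α * z.1| ≤ |D * z.1 ^ 2| + |2 * α * z.1| := abs_sub _ _
      _ = |D| * z.1 ^ 2 + 2 * |α| * |z.1| := by
          simp only [abs_mul, abs_of_nonneg (sq_nonneg z.1)]; norm_num
      _ ≤ |D| * M ^ 2 + 2 * |α| * M ^ 2 := by gcongr; exact h1.trans hM2
      _ = B * M ^ 2 := by rw [hB]; ring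
  have hBM : B * M ^ 2 ≤ B * M ^ 4 := by gcongr
  have hlarge : ∀ z ∈ S, (2 * B + 1) * M ^ 2 ≤ |z.2| := by
    intro z hz
    obtain ⟨-, h⟩ := hS z hz
    have h1 := abs_le.mp (hbd z hz)
    have h2 : ((2 * B + 1) * M ^ 2) ^ 2 ≤ z.2 ^ 2 := by
      rcases abs_cases K with ⟨e, -⟩ | ⟨e, -⟩
      · rw [e] at hK
        nlinarith
      · rw [e] at hK
        have : 0 ≤ (2 * B + 1) ^ 2 * M ^ 4 := by positivity
        nlinarith [sq_nonneg z.2]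
    exact (le_abs_self _).trans (sq_le_sq.mp h2)
  have hy : ∀ z ∈ S, |z.2| = |w.2| := by
    intro z hz
    have h1 := abs_le.mp (hbd z hz)
    have h2 := abs_le.mp (hbd w hw)
    have h3 := (hS z hz).2
    have h4 := (hS w hw).2
    have h5 := hlarge z hz
    have h6 := hlarge w hw
    have e1 := sq_abs z.2
    have e2 := sq_abs w.2
    have hM0 : 0 < M ^ 2 := by positivity
    rcases lt_trichotomy |z.2| |w.2| with h | h | h
    · nlinarith
    · exact h
    · nlinarith
  have hx : ∀ z ∈ S, |D * z.1 - α| = |D * w.1 - α| := by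
    intro z hz
    rw [← sq_eq_sq_iff_abs_eq_abs]
    have h3 := (hS z hz).2
    have h4 := (hS w hw).2
    have h5 := (sq_eq_sq_iff_abs_eq_abs _ _).mpr (hy z hz)
    linear_combination D * (h5 - h3 + h4)
  calc S.card ≤ (({D * w.1 - α, -(D * w.1 - α)} : Finset ℤ) ×ˢ ({w.2, -w.2} : Finset ℤ)).card := by
        refine Finset.card_le_card_of_injOn (fun z => (D * z.1 - α, z.2)) (fun z hz => ?_) ?_
        · simp only [Finset.coe_product, Finset.coe_insert, Finset.coe_singleton, Set.mem_prod,
            Set.mem_insert_iff, Set.mem_singleton_iff]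
          exact ⟨abs_eq_abs.mp (hx z hz), abs_eq_abs.mp (hy z hz)⟩
        · intro z _ u _ h
          simp only [Prod.mk.injEq, sub_left_inj, mul_right_inj' hD] at h
          exact Prod.ext h.1 h.2
    _ ≤ 2 * 2 := by
        rw [Finset.card_product]
        exact Nat.mul_le_mul Finset.card_le_two Finset.card_le_two

/-- A conic arc over `|m| ≤ M` carries at most `O(M ^ ε)` integer points,
uniformly in the constant term of the conic. -/
lemma exists_card_conic_le_mul_rpow {D : ℤ} (hD : ¬ IsSquare D) (α : ℤ) {ε : ℝ} (hε : 0 < ε) :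
    ∃ C : ℝ, 0 ≤ C ∧ ∀ (K : ℤ) (M : ℕ), M ≠ 0 → ∀ S : Finset (ℤ × ℤ),
      (∀ z ∈ S, |z.1| ≤ M ∧ z.2 ^ 2 = D * z.1 ^ 2 - 2 * α * z.1 + K) →
      (S.card : ℝ) ≤ C * (M : ℝ) ^ ε := by
  have hD0 : D ≠ 0 := by rintro rfl; exact hD IsSquare.zero
  obtain ⟨C, hC, h⟩ := exists_card_normFormReps_le_mul_rpow hD (half_pos hε)
  set B : ℕ := D.natAbs + 2 * α.natAbs with hB
  have hBZ : (B : ℤ) = |D| + 2 * |α| := by rw [hB]; push_cast; rfl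
  set E : ℕ := B + (B + (2 * B + 1) ^ 2) with hE
  have hE1 : 1 ≤ E := by rw [hE]; nlinarith
  refine ⟨max 4 (C * (E : ℝ) ^ (ε / 2)), by positivity, fun K M hM S hS => ?_⟩
  have hM1 : (1 : ℤ) ≤ M := by exact_mod_cast Nat.one_le_iff_ne_zero.mpr hM
  have hMε : 1 ≤ (M : ℝ) ^ ε := Real.one_le_rpow (by exact_mod_cast hM1) hε.le
  by_cases hK : ((B : ℤ) + (2 * B + 1) ^ 2) * (M : ℤ) ^ 4 < |K|
  · have : (S.card : ℝ) ≤ 4 := by exact_mod_cast card_short_conic_le_four hD0 hBZ hM1 hK hS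
    calc (S.card : ℝ) ≤ 4 * 1 := by linarith
      _ ≤ _ := by gcongr; exact le_max_left _ _
  rw [not_lt] at hK
  have hM2 : (M : ℤ) ≤ (M : ℤ) ^ 2 := by nlinarith
  have hM4 : (M : ℤ) ^ 2 ≤ (M : ℤ) ^ 4 := by nlinarith [sq_nonneg (M : ℤ)]
  have hcard : S.card ≤ (normFormReps D (α ^ 2 - D * K) (E * M ^ 2)).card := by
    refine Finset.card_le_card_of_injOn (fun z => (D * z.1 - α, z.2)) (fun z hz => ?_) ?_
    · obtain ⟨h1, h2⟩ := hS z hz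
      have h3 : z.1 ^ 2 ≤ (M : ℤ) ^ 2 := sq_le_sq' (abs_le.mp h1).1 (abs_le.mp h1).2
      refine mem_normFormReps.mpr ⟨?_, ?_, ?_⟩
      · push_cast
        calc |D * z.1 - α| ≤ |D| * |z.1| + |α| := (abs_sub _ _).trans (by rw [abs_mul])
          _ ≤ |D| * (M : ℤ) ^ 2 + |α| * (M : ℤ) ^ 2 := by
              gcongr
              · exact h1.trans hM2
              · nlinarith [abs_nonneg α]
          _ ≤ B * (M : ℤ) ^ 2 := by
              rw [hBZ]
              nlinarith [mul_nonneg (abs_nonneg α) (sq_nonneg (M : ℤ))]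
          _ ≤ E * (M : ℤ) ^ 2 := by gcongr; omega
      · refine abs_le_of_sq_le_sq ?_ (by positivity)
        have hEZ : (E : ℤ) = B + (B + (2 * B + 1) ^ 2) := by rw [hE]; push_cast; ring
        calc z.2 ^ 2 ≤ |D| * z.1 ^ 2 + 2 * |α| * |z.1| + |K| := by
              rw [h2]
              have a1 : D * z.1 ^ 2 ≤ |D| * z.1 ^ 2 := by gcongr; exact le_abs_self D
              have a2 : -(2 * α * z.1) ≤ 2 * |α| * |z.1| := by
                rw [mul_assoc, mul_assoc, ← abs_mul]
                linarith [neg_abs_le (α * z.1)]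
              linarith [le_abs_self K]
          _ ≤ |D| * (M : ℤ) ^ 4 + 2 * |α| * (M : ℤ) ^ 4
                + ((B : ℤ) + (2 * B + 1) ^ 2) * (M : ℤ) ^ 4 := by
              gcongr
              · exact h3.trans hM4
              · exact h1.trans (hM2.trans hM4)
          _ = E * (M : ℤ) ^ 4 := by rw [hEZ]; linear_combination -(M : ℤ) ^ 4 * hBZ
          _ ≤ E ^ 2 * (M : ℤ) ^ 4 := by
              gcongr
              have : (1 : ℤ) ≤ E := by exact_mod_cast hE1
              nlinarith
          _ = _ := by push_cast; ring
      · simp only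
        linear_combination -D * h2
    · intro z _ u _ h
      simp only [Prod.mk.injEq, sub_left_inj, mul_right_inj' hD0] at h
      exact Prod.ext h.1 h.2
  have hE0 : (0 : ℝ) ≤ E := by positivity
  calc (S.card : ℝ) ≤ C * ((E * M ^ 2 : ℕ) : ℝ) ^ (ε / 2) :=
        le_trans (by exact_mod_cast hcard) (h _ _ (by positivity))
    _ = C * (E : ℝ) ^ (ε / 2) * (M : ℝ) ^ ε := by
        push_cast
        rw [Real.mul_rpow hE0 (by positivity), ← Real.rpow_natCast,
          ← Real.rpow_mul (by positivity), mul_assoc]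
        congr 3
        push_cast; ring
    _ ≤ _ := by gcongr; exact le_max_right _ _

lemma tsum_ite_le_mul {ι : Type*} {p : ι → Prop} [DecidablePred p] {c n : ℝ≥0∞}
    (h : ∀ S : Finset ι, (∀ z ∈ S, p z) → (S.card : ℝ≥0∞) ≤ n) :
    ∑' z, (if p z then c else 0) ≤ n * c := by
  rw [ENNReal.tsum_eq_iSup_sum]
  refine iSup_le fun S => ?_
  rw [← Finset.sum_filter, Finset.sum_const, nsmul_eq_mul]
  gcongr
  exact h _ fun z hz => (Finset.mem_filter.mp hz).2

/-- Negative powers of the first coordinate are summable over integer points on a conic,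
uniformly in its constant term. -/
lemma exists_tsum_conic_rpow_le {D : ℤ} (hD : ¬ IsSquare D) (α : ℤ) {δ : ℝ} (hδ : 0 < δ) :
    ∃ C : ℝ≥0∞, C ≠ ⊤ ∧ ∀ K : ℤ,
      ∑' z : ℤ × ℤ, (if z.1 ≠ 0 ∧ z.2 ^ 2 = D * z.1 ^ 2 - 2 * α * z.1 + K
        then (z.1.natAbs : ℝ≥0∞) ^ (-δ) else 0) ≤ C := by
  obtain ⟨C, hC, h⟩ := exists_card_conic_le_mul_rpow hD α (half_pos hδ)
  set q : ℝ := (2 : ℝ) ^ (-(δ / 2)) with hq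
  have hq0 : 0 ≤ q := by positivity
  have hq1 : q < 1 := Real.rpow_lt_one_of_one_lt_of_neg one_lt_two (by linarith)
  have hsum : Summable fun j : ℕ => C * 2 ^ (δ / 2) * q ^ j :=
    (summable_geometric_of_lt_one hq0 hq1).mul_left _
  refine ⟨∑' j : ℕ, ENNReal.ofReal (C * 2 ^ (δ / 2) * q ^ j), hsum.tsum_ofReal_ne_top,
    fun K => ?_⟩
  let G : ℕ → ℤ × ℤ → ℝ≥0∞ := fun j z =>
    if |z.1| ≤ ((2 ^ (j + 1) : ℕ) : ℤ) ∧ z.2 ^ 2 = D * z.1 ^ 2 - 2 * α * z.1 + K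
    then ENNReal.ofReal ((2 : ℝ) ^ (-((j : ℝ) * δ))) else 0
  calc _ ≤ ∑' z : ℤ × ℤ, ∑' j : ℕ, G j z := by
        refine ENNReal.tsum_le_tsum fun z => ?_
        split_ifs with hz
        · obtain ⟨h0, hz⟩ := hz
          refine le_trans ?_ (ENNReal.le_tsum (Nat.log 2 z.1.natAbs))
          have hn : z.1.natAbs ≠ 0 := by simpa using h0
          have h1 := Nat.lt_pow_succ_log_self one_lt_two z.1.natAbs
          have h2 := Nat.pow_log_le_self 2 hn
          have hcond : |z.1| ≤ ((2 ^ (Nat.log 2 z.1.natAbs + 1) : ℕ) : ℤ) := by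
            rw [Int.abs_eq_natAbs]; exact_mod_cast h1.le
          simp only [G]
          rw [if_pos ⟨hcond, hz⟩, ← ENNReal.ofReal_natCast,
            ENNReal.ofReal_rpow_of_pos (by positivity)]
          apply ENNReal.ofReal_le_ofReal
          rw [← mul_neg, Real.rpow_mul two_pos.le, Real.rpow_natCast]
          refine Real.rpow_le_rpow_of_nonpos (by positivity) ?_ (by linarith)
          exact_mod_cast h2
        · exact zero_le
    _ = ∑' j : ℕ, ∑' z : ℤ × ℤ, G j z := ENNReal.tsum_comm
    _ ≤ _ := by
        refine ENNReal.tsum_le_tsum fun j => ?_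
        refine (tsum_ite_le_mul (n := ENNReal.ofReal (C * ((2 ^ (j + 1) : ℕ) : ℝ) ^ (δ / 2)))
          fun S hS => ?_).trans ?_
        · rw [← ENNReal.ofReal_natCast]
          exact ENNReal.ofReal_le_ofReal (h K _ (by positivity) S hS)
        · rw [← ENNReal.ofReal_mul (by positivity)]
          refine ENNReal.ofReal_le_ofReal (le_of_eq ?_)
          rw [hq, ← Real.rpow_natCast, ← Real.rpow_mul two_pos.le, mul_assoc, mul_assoc]
          congr 1
          push_cast
          rw [← Real.rpow_natCast, ← Real.rpow_mul two_pos.le, ← Real.rpow_add two_pos,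
            ← Real.rpow_add two_pos]
          congr 1
          push_cast; ring

/-- Jensen's inequality for weighted series. -/
lemma tsum_mul_rpow_le {ι : Type*} {p : ℝ} (hp : 1 ≤ p) (w g : ι → ℝ≥0∞) :
    (∑' i, w i * g i) ^ p ≤ (∑' i, w i) ^ (p - 1) * ∑' i, w i * g i ^ p := by
  have hp0 : 0 < p := by linarith
  have h : ∑' i, w i * g i ≤ (∑' i, w i) ^ (1 - p⁻¹) * (∑' i, w i * g i ^ p) ^ p⁻¹ := by
    rw [ENNReal.tsum_eq_iSup_sum]
    refine iSup_le fun S => (ENNReal.inner_le_weight_mul_Lp_of_nonneg S hp w g).trans ?_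
    have : 0 ≤ 1 - p⁻¹ := sub_nonneg.mpr (inv_le_one_of_one_le₀ hp)
    gcongr <;> exact ENNReal.sum_le_tsum S
  refine (ENNReal.rpow_le_rpow h hp0.le).trans (le_of_eq ?_)
  rw [ENNReal.mul_rpow_of_nonneg _ _ hp0.le, ← ENNReal.rpow_mul, ← ENNReal.rpow_mul,
    inv_mul_cancel₀ hp0.ne', ENNReal.rpow_one, sub_mul, one_mul, inv_mul_cancel₀ hp0.ne']

lemma tsum_natAbs_rpow_ne_top {μ : ℝ} (hμ : 1 < μ) :
    ∑' m : {m : ℤ // m ≠ 0}, ((m : ℤ).natAbs : ℝ≥0∞) ^ (-μ) ≠ ⊤ := by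
  have h := ((Real.summable_abs_int_rpow hμ).subtype {m : ℤ | m ≠ 0}).tsum_ofReal_ne_top
  convert h using 1
  refine tsum_congr fun m => ?_
  have hm : (m : ℤ).natAbs ≠ 0 := by simpa using m.2
  rw [← ENNReal.ofReal_natCast, ENNReal.ofReal_rpow_of_pos (by positivity)]
  simp [Nat.cast_natAbs]

/-- Discrete fractional integral along an integral bivariate quadratic polynomial
with negative or positive nonsquare discriminant: `ℓ^p` boundedness for
`λ > 1 - 1/p`, with constant depending only on `λ, p, Δ, α`. -/
theorem stmt_1 (p lam : ℝ) (hp : 1 ≤ p) (hlam : 1 - 1 / p < lam)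
    (Δ α : ℤ) (hΔ : Δ < 0 ∨ (0 < Δ ∧ ¬∃ t : ℤ, t ^ 2 = Δ)) :
    ∃ C : ℝ≥0∞, C ≠ ⊤ ∧
      ∀ a b c d e f₀ : ℤ, b ^ 2 - 4 * a * c = Δ → 2 * c * d - b * e = α →
        ∀ f : ℤ → ℝ≥0∞,
          ∑' n : ℤ,
              (∑' m : {m : ℤ // m ≠ 0},
                  f (a * (m : ℤ) ^ 2 + b * (m : ℤ) * n + c * n ^ 2 +
                      d * (m : ℤ) + e * n + f₀) /
                    (((m : ℤ).natAbs : ℝ≥0∞)) ^ lam) ^ p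
            ≤ C ^ p * ∑' k : ℤ, f k ^ p := by
  have hp0 : 0 < p := by linarith
  have hsq : ¬ IsSquare Δ := by
    rintro ⟨t, ht⟩
    rcases hΔ with h | ⟨-, h⟩
    · nlinarith [mul_self_nonneg t]
    · exact h ⟨t, by rw [ht, sq]⟩
  have hlp : 0 < lam * p - (p - 1) := by
    have : (1 - 1 / p) * p < lam * p := by gcongr
    rw [sub_mul, one_mul, one_div, inv_mul_cancel₀ hp0.ne'] at this
    linarith
  obtain ⟨μ, hμ, hμp⟩ : ∃ μ : ℝ, 1 < μ ∧ μ * (p - 1) < lam * p := by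
    refine ⟨1 + (lam * p - (p - 1)) / (2 * p), by
      have : 0 < (lam * p - (p - 1)) / (2 * p) := by positivity
      linarith, ?_⟩
    have : (lam * p - (p - 1)) / (2 * p) * (p - 1) ≤ (lam * p - (p - 1)) / (2 * p) * p := by
      gcongr; linarith
    have e : (lam * p - (p - 1)) / (2 * p) * p = (lam * p - (p - 1)) / 2 := by field_simp
    linarith
  obtain ⟨C, hC, hconic⟩ := exists_tsum_conic_rpow_le hsq α (sub_pos.mpr hμp)
  set δ : ℝ := lam * p - μ * (p - 1) with hδ
  set W : ℝ≥0∞ := ∑' m : {m : ℤ // m ≠ 0}, ((m : ℤ).natAbs : ℝ≥0∞) ^ (-μ) with hW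
  have hWt : W ^ (p - 1) ≠ ⊤ :=
    ENNReal.rpow_ne_top_of_nonneg (by linarith) (tsum_natAbs_rpow_ne_top hμ)
  refine ⟨(W ^ (p - 1) * C) ^ p⁻¹,
    ENNReal.rpow_ne_top_of_nonneg (by positivity) (ENNReal.mul_ne_top hWt hC), ?_⟩
  intro a b c d e f₀ hdisc hα f
  rw [← ENNReal.rpow_mul, inv_mul_cancel₀ hp0.ne', ENNReal.rpow_one]
  have hc : c ≠ 0 := by
    rintro rfl
    exact hsq ⟨b, by rw [← hdisc]; ring⟩
  set P : ℤ → ℤ → ℤ := fun m n => a * m ^ 2 + b * m * n + c * n ^ 2 + d * m + e * n + f₀ with hP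
  have hinner : ∀ n : ℤ, (∑' m : {m : ℤ // m ≠ 0}, f (P m n) / ((m : ℤ).natAbs : ℝ≥0∞) ^ lam) ^ p
      ≤ W ^ (p - 1) * ∑' m : {m : ℤ // m ≠ 0}, f (P m n) ^ p * ((m : ℤ).natAbs : ℝ≥0∞) ^ (-δ) := by
    intro n
    convert tsum_mul_rpow_le hp (fun m : {m : ℤ // m ≠ 0} => ((m : ℤ).natAbs : ℝ≥0∞) ^ (-μ))
      (fun m => f (P m n) * ((m : ℤ).natAbs : ℝ≥0∞) ^ (μ - lam)) using 4 with m m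
    · have hm : ((m : ℤ).natAbs : ℝ≥0∞) ≠ 0 := by simpa using m.2
      rw [mul_left_comm, ← ENNReal.rpow_add _ _ hm (ENNReal.natCast_ne_top _), div_eq_mul_inv,
        ← ENNReal.rpow_neg]
      congr 2; ring
    · have hm : ((m : ℤ).natAbs : ℝ≥0∞) ≠ 0 := by simpa using m.2
      rw [ENNReal.mul_rpow_of_nonneg _ _ hp0.le, mul_left_comm, ← ENNReal.rpow_mul,
        ← ENNReal.rpow_add _ _ hm (ENNReal.natCast_ne_top _)]
      congr 2; rw [hδ]; ring
  have hfiber : ∀ k : ℤ, ∑' n : ℤ, ∑' m : {m : ℤ // m ≠ 0},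
      (if P m n = k then ((m : ℤ).natAbs : ℝ≥0∞) ^ (-δ) else 0) ≤ C := by
    intro k
    rw [← ENNReal.tsum_prod (f := fun (n : ℤ) (m : {m : ℤ // m ≠ 0}) =>
      if P m n = k then ((m : ℤ).natAbs : ℝ≥0∞) ^ (-δ) else 0)]
    have hinj : Function.Injective fun q : ℤ × {m : ℤ // m ≠ 0} =>
        ((q.2 : ℤ), 2 * c * q.1 + b * q.2 + e) := by
      rintro ⟨n, m⟩ ⟨n', m'⟩ h
      simp only [Prod.mk.injEq] at h
      obtain ⟨h1, h2⟩ := h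
      have h3 : m = m' := Subtype.ext h1
      subst h3
      refine Prod.ext (mul_left_cancel₀ (mul_ne_zero two_ne_zero hc) ?_) rfl
      simp only
      linarith
    refine le_trans ?_ ((ENNReal.tsum_comp_le_tsum_of_injective hinj _).trans
      (hconic (4 * c * k - 4 * c * f₀ + e ^ 2)))
    refine ENNReal.tsum_le_tsum fun q => ?_
    by_cases hk : P q.2 q.1 = k
    · rw [if_pos hk, if_pos]
      refine ⟨q.2.2, ?_⟩
      simp only [hP] at hk
      rw [← hk, ← hdisc, ← hα]
      ring
    · rw [if_neg hk]
      exact zero_le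
  calc _ ≤ ∑' n : ℤ, W ^ (p - 1) *
          ∑' m : {m : ℤ // m ≠ 0}, f (P m n) ^ p * ((m : ℤ).natAbs : ℝ≥0∞) ^ (-δ) :=
        ENNReal.tsum_le_tsum hinner
    _ = W ^ (p - 1) * ∑' k : ℤ, f k ^ p * ∑' n : ℤ, ∑' m : {m : ℤ // m ≠ 0},
          (if P m n = k then ((m : ℤ).natAbs : ℝ≥0∞) ^ (-δ) else 0) := by
        rw [ENNReal.tsum_mul_left]
        congr 1
        simp_rw [← ENNReal.tsum_mul_left]
        rw [ENNReal.tsum_comm (α := ℤ) (β := ℤ)]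
        refine tsum_congr fun n => ?_
        rw [ENNReal.tsum_comm]
        refine tsum_congr fun m => ?_
        rw [tsum_eq_single (P m n) fun k hk => by rw [if_neg hk.symm, mul_zero], if_pos rfl]
    _ ≤ W ^ (p - 1) * ∑' k : ℤ, f k ^ p * C := by
        gcongr with k
        exact hfiber k
    _ = _ := by rw [ENNReal.tsum_mul_right]; ring
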